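/- arXiv:1801.05584 — 2 statements merged into one kernel-verified Lean document; each statement's English description precedes it below -/
import Mathlib

section
/- For every nonzero z in R^3 written as z = |z|(sin\alpha cos\beta, sin\alpha sin\beta, cos\alpha) and every k > 0, \int_{S^2} d_3^2 e^{i k d\cdot z} ds(d) = (4\pi/3) j_0(k|z|) - (4\pi/3) j_2(k|z|)(3 cos^2\alpha - 1), where d_3 is the third coordinate of d on the unit sphere. -/
open Real MeasureTheory

/-- Spherical Bessel function of order 0. -/
noncomputable def sphBesselj0 (t : ℝ) : ℝ := Real.sin t / t

/-- Spherical Bessel function of order 2. -/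
noncomputable def sphBesselj2 (t : ℝ) : ℝ :=
  (3/t^3 - 1/t) * Real.sin t - (3/t^2) * Real.cos t

noncomputable def gS (C S r u v : ℝ) : ℂ :=
  ((C * u - S * v : ℝ) : ℂ) ^ 2 * Complex.exp (Complex.I * ((r * u : ℝ) : ℂ))

noncomputable def dgS (C S r u v u' v' : ℝ) : ℂ :=
  (2 * ((C * u - S * v : ℝ) : ℂ) * ((C * u' - S * v' : ℝ) : ℂ)
    + Complex.I * ((r * u' : ℝ) : ℂ) * ((C * u - S * v : ℝ) : ℂ) ^ 2)
    * Complex.exp (Complex.I * ((r * u : ℝ) : ℂ))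

lemma hasDerivAt_gS (C S r : ℝ) {u v : ℝ → ℝ} {u' v' x : ℝ}
    (hu : HasDerivAt u u' x) (hv : HasDerivAt v v' x) :
    HasDerivAt (fun x => gS C S r (u x) (v x)) (dgS C S r (u x) (v x) u' v') x := by
  unfold gS dgS
  have h1 : HasDerivAt (fun x => ((C * u x - S * v x : ℝ) : ℂ)) ((C * u' - S * v' : ℝ) : ℂ) x :=
    ((hu.const_mul C).sub (hv.const_mul S)).ofReal_comp
  have h2 : HasDerivAt (fun x => ((r * u x : ℝ) : ℂ)) ((r * u' : ℝ) : ℂ) x :=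
    (hu.const_mul r).ofReal_comp
  have h3 := (h1.pow 2).mul (h2.const_mul Complex.I).cexp
  refine h3.congr_deriv ?_
  simp only [Pi.pow_apply]
  push_cast
  ring

noncomputable def uS (a t p : ℝ) : ℝ := sin a * (sin t * cos p) + cos a * cos t
noncomputable def vS (a t p : ℝ) : ℝ := cos a * (sin t * cos p) - sin a * cos t

lemma uS_a (a t p : ℝ) : HasDerivAt (fun a => uS a t p) (vS a t p) a := by
  unfold uS vS
  refine (((hasDerivAt_sin a).mul_const _).add ((hasDerivAt_cos a).mul_const _)).congr_deriv ?_
  ring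
lemma vS_a (a t p : ℝ) : HasDerivAt (fun a => vS a t p) (-uS a t p) a := by
  unfold uS vS
  refine (((hasDerivAt_cos a).mul_const _).sub ((hasDerivAt_sin a).mul_const _)).congr_deriv ?_
  ring
lemma uS_t (a t p : ℝ) : HasDerivAt (fun t => uS a t p)
    (sin a * (cos t * cos p) - cos a * sin t) t := by
  unfold uS
  refine ((((hasDerivAt_sin t).mul_const _).const_mul _).add
    ((hasDerivAt_cos t).const_mul _)).congr_deriv ?_
  ring
lemma vS_t (a t p : ℝ) : HasDerivAt (fun t => vS a t p)
    (cos a * (cos t * cos p) + sin a * sin t) t := by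
  unfold vS
  refine ((((hasDerivAt_sin t).mul_const _).const_mul _).sub
    ((hasDerivAt_cos t).const_mul _)).congr_deriv ?_
  ring
lemma uS_p (a t p : ℝ) : HasDerivAt (fun p => uS a t p) (-(sin a * (sin t * sin p))) p := by
  unfold uS
  refine ((((hasDerivAt_cos p).const_mul _).const_mul _).add_const _).congr_deriv ?_
  ring
lemma vS_p (a t p : ℝ) : HasDerivAt (fun p => vS a t p) (-(cos a * (sin t * sin p))) p := by
  unfold vS
  refine ((((hasDerivAt_cos p).const_mul _).const_mul _).sub_const _).congr_deriv ?_
  ring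

noncomputable def DP (C S r a t p : ℝ) : ℂ :=
  dgS C S r (uS a t p) (vS a t p) (sin a * (cos t * cos p) - cos a * sin t)
    (cos a * (cos t * cos p) + sin a * sin t) * ((cos p * sin t : ℝ) : ℂ)
  + gS C S r (uS a t p) (vS a t p) * ((cos p * cos t : ℝ) : ℂ)

noncomputable def DQ (C S r a t p : ℝ) : ℂ :=
  dgS C S r (uS a t p) (vS a t p) (-(sin a * (sin t * sin p)))
    (-(cos a * (sin t * sin p))) * ((cos t * sin p : ℝ) : ℂ)
  + gS C S r (uS a t p) (vS a t p) * ((cos t * cos p : ℝ) : ℂ)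

lemma hasDeriv_P (C S r a t p : ℝ) : HasDerivAt
    (fun t => gS C S r (uS a t p) (vS a t p) * ((cos p * sin t : ℝ) : ℂ)) (DP C S r a t p) t :=
  (hasDerivAt_gS C S r (uS_t a t p) (vS_t a t p)).mul
    ((hasDerivAt_sin t).const_mul (cos p)).ofReal_comp

lemma hasDeriv_Q (C S r a t p : ℝ) : HasDerivAt
    (fun p => gS C S r (uS a t p) (vS a t p) * ((cos t * sin p : ℝ) : ℂ)) (DQ C S r a t p) p :=
  (hasDerivAt_gS C S r (uS_p a t p) (vS_p a t p)).mul
    ((hasDerivAt_sin p).const_mul (cos t)).ofReal_comp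

lemma hasDeriv_A (C S r a t p : ℝ) : HasDerivAt
    (fun a => gS C S r (uS a t p) (vS a t p) * ((sin t : ℝ) : ℂ))
    (DQ C S r a t p - DP C S r a t p) a := by
  refine ((hasDerivAt_gS C S r (uS_a a t p) (vS_a a t p)).mul_const _).congr_deriv ?_
  have key : ∀ A B A1 B1 A2 B2 A3 B3 : ℝ, A * sin t = A2 * (cos t * sin p) - A1 * (cos p * sin t) →
      B * sin t = B2 * (cos t * sin p) - B1 * (cos p * sin t) →
      dgS C S r (uS a t p) (vS a t p) A B * ((sin t : ℝ) : ℂ) =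
      dgS C S r (uS a t p) (vS a t p) A2 B2 * ((cos t * sin p : ℝ) : ℂ)
      - dgS C S r (uS a t p) (vS a t p) A1 B1 * ((cos p * sin t : ℝ) : ℂ) := by
    intro A B A1 B1 A2 B2 A3 B3 hA hB
    have hA' := congrArg (fun x : ℝ => (x : ℂ)) hA
    have hB' := congrArg (fun x : ℝ => (x : ℂ)) hB
    simp only [Complex.ofReal_mul, Complex.ofReal_sub] at hA' hB'
    unfold dgS
    simp only [Complex.ofReal_mul, Complex.ofReal_sub]
    generalize Complex.exp _ = E
    set M := (C:ℂ) * (uS a t p : ℂ) - S * (vS a t p : ℂ)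
    linear_combination (2 * M * C * E + Complex.I * r * M ^ 2 * E) * hA' - (2 * M * S * E) * hB'
  rw [key _ _ (sin a * (cos t * cos p) - cos a * sin t)
    (cos a * (cos t * cos p) + sin a * sin t) (-(sin a * (sin t * sin p)))
    (-(cos a * (sin t * sin p))) 0 0]
  · unfold DP DQ
    push_cast
    ring
  · unfold vS
    have h := sin_sq_add_cos_sq p
    linear_combination (-sin a * cos t * sin t) * (-h)
  · unfold uS
    have h := sin_sq_add_cos_sq p
    linear_combination (cos a * cos t * sin t) * h

lemma cont_DP (C S r : ℝ) : Continuous (fun x : ℝ × ℝ × ℝ => DP C S r x.1 x.2.1 x.2.2) := by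
  unfold DP dgS gS uS vS; fun_prop
lemma cont_DQ (C S r : ℝ) : Continuous (fun x : ℝ × ℝ × ℝ => DQ C S r x.1 x.2.1 x.2.2) := by
  unfold DQ dgS gS uS vS; fun_prop

lemma swap_cont {F : ℝ → ℝ → ℂ} (hF : Continuous (Function.uncurry F)) (a b c d : ℝ) :
    ∫ x in a..b, ∫ y in c..d, F x y = ∫ y in c..d, ∫ x in a..b, F x y := by
  apply intervalIntegral_intervalIntegral_swap
  exact (hF.continuousOn.integrableOn_compact (isCompact_uIcc.prod isCompact_uIcc)).mono_set
    (Set.prod_mono Set.uIoc_subset_uIcc Set.uIoc_subset_uIcc)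

lemma param_cont {F : ℝ × ℝ → ℝ → ℂ} (hF : Continuous (Function.uncurry F)) (c d : ℝ) :
    Continuous (fun x => ∫ y in c..d, F x y) :=
  intervalIntegral.continuous_parametric_intervalIntegral_of_continuous' hF c d

lemma int_DQ (C S r A : ℝ) :
    ∫ t in (0:ℝ)..π, ∫ p in (0:ℝ)..(2*π), ∫ a in (0:ℝ)..A, DQ C S r a t p = 0 := by
  have hc := cont_DQ C S r
  have : ∀ t : ℝ, ∫ p in (0:ℝ)..(2*π), ∫ a in (0:ℝ)..A, DQ C S r a t p = 0 := by
    intro t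
    rw [swap_cont (F := fun p a => DQ C S r a t p)
      (hc.comp (f := fun x : ℝ × ℝ => (x.2, t, x.1)) (by fun_prop))]
    have : ∀ a : ℝ, ∫ p in (0:ℝ)..(2*π), DQ C S r a t p = 0 := by
      intro a
      rw [intervalIntegral.integral_eq_sub_of_hasDerivAt (fun p _ => hasDeriv_Q C S r a t p)
        ((hc.comp (f := fun p : ℝ => (a, t, p)) (by fun_prop)).intervalIntegrable _ _)]
      simp
    simp [this]
  simp [this]

lemma int_DP (C S r A : ℝ) :
    ∫ t in (0:ℝ)..π, ∫ p in (0:ℝ)..(2*π), ∫ a in (0:ℝ)..A, DP C S r a t p = 0 := by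
  have hc := cont_DP C S r
  rw [swap_cont (F := fun t p => ∫ a in (0:ℝ)..A, DP C S r a t p)
    (param_cont (F := fun x a => DP C S r a x.1 x.2)
      (hc.comp (f := fun x : (ℝ × ℝ) × ℝ => (x.2, x.1.1, x.1.2)) (by fun_prop)) _ _)]
  have : ∀ p : ℝ, ∫ t in (0:ℝ)..π, ∫ a in (0:ℝ)..A, DP C S r a t p = 0 := by
    intro p
    rw [swap_cont (F := fun t a => DP C S r a t p)
      (hc.comp (f := fun x : ℝ × ℝ => (x.2, x.1, p)) (by fun_prop))]
    have : ∀ a : ℝ, ∫ t in (0:ℝ)..π, DP C S r a t p = 0 := by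
      intro a
      rw [intervalIntegral.integral_eq_sub_of_hasDerivAt (fun t _ => hasDeriv_P C S r a t p)
        ((hc.comp (f := fun t : ℝ => (a, t, p)) (by fun_prop)).intervalIntegrable _ _)]
      simp
    simp [this]
  simp [this]

lemma rot_inv (C S r A : ℝ) :
    ∫ t in (0:ℝ)..π, ∫ p in (0:ℝ)..(2*π), gS C S r (uS A t p) (vS A t p) * ((sin t : ℝ) : ℂ)
    = ∫ t in (0:ℝ)..π, ∫ p in (0:ℝ)..(2*π),
      gS C S r (uS 0 t p) (vS 0 t p) * ((sin t : ℝ) : ℂ) := by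
  have hP := cont_DP C S r
  have hQ := cont_DQ C S r
  have hA : ∀ A : ℝ, Continuous (fun x : ℝ × ℝ =>
      gS C S r (uS A x.1 x.2) (vS A x.1 x.2) * ((sin x.1 : ℝ) : ℂ)) := by
    intro A; unfold gS uS vS; fun_prop
  have hPc : Continuous (fun x : ℝ × ℝ => ∫ a in (0:ℝ)..A, DP C S r a x.1 x.2) :=
    param_cont (F := fun x a => DP C S r a x.1 x.2)
      (hP.comp (f := fun x : (ℝ × ℝ) × ℝ => (x.2, x.1.1, x.1.2)) (by fun_prop)) _ _
  have hQc : Continuous (fun x : ℝ × ℝ => ∫ a in (0:ℝ)..A, DQ C S r a x.1 x.2) :=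
    param_cont (F := fun x a => DQ C S r a x.1 x.2)
      (hQ.comp (f := fun x : (ℝ × ℝ) × ℝ => (x.2, x.1.1, x.1.2)) (by fun_prop)) _ _
  have pt : ∀ t p : ℝ, gS C S r (uS A t p) (vS A t p) * ((sin t : ℝ) : ℂ)
      = gS C S r (uS 0 t p) (vS 0 t p) * ((sin t : ℝ) : ℂ)
        + ((∫ a in (0:ℝ)..A, DQ C S r a t p) - ∫ a in (0:ℝ)..A, DP C S r a t p) := by
    intro t p
    have i1 := (hQ.comp (f := fun a : ℝ => (a, t, p)) (by fun_prop)).intervalIntegrable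
      (μ := volume) 0 A
    have i2 := (hP.comp (f := fun a : ℝ => (a, t, p)) (by fun_prop)).intervalIntegrable
      (μ := volume) 0 A
    have h := intervalIntegral.integral_eq_sub_of_hasDerivAt
      (fun a _ => hasDeriv_A C S r a t p) (i1.sub i2)
    have h' := intervalIntegral.integral_sub i1 i2
    simp only [Function.comp_def] at h'
    rw [← h', h]; ring
  have inner : ∀ t : ℝ,
      ∫ p in (0:ℝ)..(2*π), gS C S r (uS A t p) (vS A t p) * ((sin t : ℝ) : ℂ)
      = (∫ p in (0:ℝ)..(2*π), gS C S r (uS 0 t p) (vS 0 t p) * ((sin t : ℝ) : ℂ))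
       + ((∫ p in (0:ℝ)..(2*π), ∫ a in (0:ℝ)..A, DQ C S r a t p)
         - ∫ p in (0:ℝ)..(2*π), ∫ a in (0:ℝ)..A, DP C S r a t p) := by
    intro t
    have i0 := ((hA 0).comp (f := fun p : ℝ => (t, p)) (by fun_prop)).intervalIntegrable
      (μ := volume) 0 (2*π)
    have i1 := (hQc.comp (f := fun p : ℝ => (t, p)) (by fun_prop)).intervalIntegrable
      (μ := volume) 0 (2*π)
    have i2 := (hPc.comp (f := fun p : ℝ => (t, p)) (by fun_prop)).intervalIntegrable
      (μ := volume) 0 (2*π)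
    simp only [Function.comp_def] at i0 i1 i2
    rw [← intervalIntegral.integral_sub i1 i2, ← intervalIntegral.integral_add i0 (i1.sub i2)]
    exact intervalIntegral.integral_congr (fun p _ => pt t p)
  have c1 : ∀ {G : ℝ × ℝ → ℂ}, Continuous G → IntervalIntegrable
      (fun t => ∫ p in (0:ℝ)..(2*π), G (t, p)) volume 0 π := fun {G} hG =>
    (intervalIntegral.continuous_parametric_intervalIntegral_of_continuous'
      (f := fun t p => G (t, p)) hG 0 (2*π)).intervalIntegrable _ _
  have j0 := c1 (hA 0)
  have j1 := c1 hQc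
  have j2 := c1 hPc
  simp only at j0 j1 j2
  simp only [inner]
  rw [intervalIntegral.integral_add j0 (j1.sub j2), intervalIntegral.integral_sub j1 j2,
    int_DQ, int_DP]
  simp

lemma inner0 (C S r t : ℝ) :
    ∫ p in (0:ℝ)..(2*π), gS C S r (uS 0 t p) (vS 0 t p) * ((sin t : ℝ) : ℂ)
    = ((π * (2 * C^2 * cos t ^ 2 + S^2 * sin t ^ 2) : ℝ) : ℂ)
      * Complex.exp (Complex.I * ((r * cos t : ℝ) : ℂ)) * ((sin t : ℝ) : ℂ) := by
  have e : ∀ p : ℝ, gS C S r (uS 0 t p) (vS 0 t p) * ((sin t : ℝ) : ℂ)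
      = (((C * cos t - S * (sin t * cos p)) ^ 2 : ℝ) : ℂ) *
        (Complex.exp (Complex.I * ((r * cos t : ℝ) : ℂ)) * ((sin t : ℝ) : ℂ)) := by
    intro p
    simp only [gS, uS, vS, sin_zero, cos_zero]
    push_cast
    ring_nf
  have q : ∫ p in (0:ℝ)..(2*π), (C * cos t - S * (sin t * cos p)) ^ 2
      = π * (2 * C^2 * cos t ^ 2 + S^2 * sin t ^ 2) := by
    have d : ∀ p ∈ Set.uIcc (0:ℝ) (2*π), HasDerivAt (fun p => C^2 * cos t^2 * p
        - 2 * C * cos t * S * sin t * sin p + S^2 * sin t ^2 * ((p + sin p * cos p) / 2))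
        ((C * cos t - S * (sin t * cos p)) ^ 2) p := by
      intro p _
      have h1 := (hasDerivAt_id p).const_mul (C^2 * cos t^2)
      have h2 := (hasDerivAt_sin p).const_mul (2 * C * cos t * S * sin t)
      have h3 := (((hasDerivAt_id p).add ((hasDerivAt_sin p).mul (hasDerivAt_cos p))).div_const
        2).const_mul (S^2 * sin t ^2)
      refine ((h1.sub h2).add h3).congr_deriv ?_
      have h := sin_sq_add_cos_sq p
      linear_combination (-S^2 * sin t^2 / 2) * h
    rw [intervalIntegral.integral_eq_sub_of_hasDerivAt d
      (Continuous.intervalIntegrable (by fun_prop) _ _)]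
    simp
    ring
  simp only [e]
  rw [intervalIntegral.integral_mul_const, intervalIntegral.integral_ofReal, q]
  ring

lemma outer0 (a b r : ℝ) (hr : r ≠ 0) :
    ∫ t in (0:ℝ)..π, ((a * cos t ^ 2 + b : ℝ) : ℂ)
      * Complex.exp (Complex.I * ((r * cos t : ℝ) : ℂ)) * ((sin t : ℝ) : ℂ)
    = ((a * (2 * sin r / r + 4 * cos r / r^2 - 4 * sin r / r^3) + b * (2 * sin r / r) : ℝ) : ℂ) := by
  have hr' : (r : ℂ) ≠ 0 := by exact_mod_cast hr
  have hI := Complex.I_sq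
  have d : ∀ t ∈ Set.uIcc (0:ℝ) π, HasDerivAt (fun t : ℝ =>
      -((a * (-Complex.I * (cos t : ℂ)^2 / r + 2 * (cos t : ℂ) / r^2 + 2 * Complex.I / r^3)
        - b * Complex.I / r) * Complex.exp (Complex.I * ((r * cos t : ℝ) : ℂ))))
      (((a * cos t ^ 2 + b : ℝ) : ℂ)
      * Complex.exp (Complex.I * ((r * cos t : ℝ) : ℂ)) * ((sin t : ℝ) : ℂ)) t := by
    intro t _
    have hc := (hasDerivAt_cos t).ofReal_comp
    have he := (((hasDerivAt_cos t).const_mul r).ofReal_comp.const_mul Complex.I).cexp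
    have h1 := ((hc.pow 2).const_mul (-Complex.I)).div_const (r:ℂ)
    have h2 := (hc.const_mul 2).div_const ((r:ℂ)^2)
    have h3 := ((((h1.add h2).add_const (2 * Complex.I / (r:ℂ)^3)).const_mul (a:ℂ)).sub_const
      (b * Complex.I / r)).mul he
    refine h3.neg.congr_deriv ?_
    simp only [Pi.pow_apply, Pi.add_apply]
    push_cast
    generalize Complex.exp _ = E
    field_simp
    ring_nf
    simp only [Complex.I_sq]
    ring_nf
  rw [intervalIntegral.integral_eq_sub_of_hasDerivAt d
      (Continuous.intervalIntegrable (by fun_prop) _ _)]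
  have e1 : Complex.exp (Complex.I * ((r * cos 0 : ℝ) : ℂ)) = cos r + sin r * Complex.I := by
    rw [cos_zero, mul_one, mul_comm, Complex.exp_mul_I]; push_cast; rfl
  have e2 : Complex.exp (Complex.I * ((r * cos π : ℝ) : ℂ)) = cos r - sin r * Complex.I := by
    rw [cos_pi, mul_comm, Complex.exp_mul_I]; push_cast
    rw [mul_neg_one, Complex.cos_neg, Complex.sin_neg]; ring
  rw [e1, e2]
  simp only [cos_zero, cos_pi]
  push_cast
  field_simp
  ring_nf
  simp only [Complex.I_sq]
  ring_nf

theorem sphere_integral_d3_sq_exp (z : EuclideanSpace ℝ (Fin 3)) (hz : z ≠ 0)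
    (k α β : ℝ) (hk : 0 < k)
    (h0 : z 0 = ‖z‖ * Real.sin α * Real.cos β)
    (h1 : z 1 = ‖z‖ * Real.sin α * Real.sin β)
    (h2 : z 2 = ‖z‖ * Real.cos α) :
    (∫ θ in (0:ℝ)..π, ∫ φ in (0:ℝ)..(2*π),
        ((Real.cos θ)^2 : ℂ) * Complex.exp (Complex.I * (k * (Real.sin θ * Real.cos φ * z 0
          + Real.sin θ * Real.sin φ * z 1 + Real.cos θ * z 2))) * (Real.sin θ : ℂ))
      = ((4 * π / 3) * sphBesselj0 (k * ‖z‖)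
          - (4 * π / 3) * sphBesselj2 (k * ‖z‖) * (3 * (Real.cos α)^2 - 1) : ℝ) := by
  have hn : ‖z‖ ≠ 0 := norm_ne_zero_iff.mpr hz
  have hr : k * ‖z‖ ≠ 0 := mul_ne_zero hk.ne' hn
  have inner : ∀ θ : ℝ, (∫ φ in (0:ℝ)..(2*π),
        ((Real.cos θ)^2 : ℂ) * Complex.exp (Complex.I * (k * (Real.sin θ * Real.cos φ * z 0
          + Real.sin θ * Real.sin φ * z 1 + Real.cos θ * z 2))) * (Real.sin θ : ℂ))
      = ∫ p in (0:ℝ)..(2*π), gS (cos α) (sin α) (k * ‖z‖) (uS α θ p) (vS α θ p)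
          * ((sin θ : ℝ) : ℂ) := by
    intro θ
    set G : ℝ → ℂ := fun p => gS (cos α) (sin α) (k * ‖z‖) (uS α θ p) (vS α θ p)
          * ((sin θ : ℝ) : ℂ) with hG
    have per : Function.Periodic G (2*π) := by
      intro p
      simp only [hG, uS, vS, cos_add_two_pi]
    have e : ∀ φ : ℝ, ((Real.cos θ)^2 : ℂ) * Complex.exp (Complex.I * (k * (Real.sin θ * Real.cos φ * z 0
          + Real.sin θ * Real.sin φ * z 1 + Real.cos θ * z 2))) * (Real.sin θ : ℂ) = G (φ - β) := by
      intro φ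
      have w1 : cos α * uS α θ (φ - β) - sin α * vS α θ (φ - β) = cos θ := by
        unfold uS vS
        linear_combination cos θ * sin_sq_add_cos_sq α
      have w2 : k * ‖z‖ * uS α θ (φ - β) = k * (Real.sin θ * Real.cos φ * z 0
          + Real.sin θ * Real.sin φ * z 1 + Real.cos θ * z 2) := by
        rw [h0, h1, h2, uS, cos_sub]; ring
      simp only [hG, gS]
      rw [w1, w2]
      push_cast
      rfl
    simp only [e]
    rw [intervalIntegral.integral_comp_sub_right G β]
    have := per.intervalIntegral_add_eq (0 - β) 0
    rw [zero_add] at this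
    rw [← this]
    congr 1
    ring
  simp only [inner]
  rw [rot_inv]
  simp only [inner0]
  have e : ∀ t : ℝ, π * (2 * cos α^2 * cos t ^ 2 + sin α^2 * sin t ^ 2)
      = (π * (3 * cos α ^ 2 - 1)) * cos t ^ 2 + π * (1 - cos α ^ 2) := by
    intro t
    rw [sin_sq, sin_sq]; ring
  simp only [e]
  rw [outer0 _ _ _ hr]
  congr 1
  unfold sphBesselj0 sphBesselj2
  field_simp
  ring
end

section
/- For every nonzero z in R^3 written as z = |z|(sin\alpha cos\beta, sin\alpha sin\beta, cos\alpha) and every k > 0, \int_{S^2} d_1 d_2 e^{i k d\cdot z} ds(d) = -2\pi j_2(k|z|) sin^2\alpha sin(2\beta), where d_1, d_2 are the first two coordinates of d on the unit sphere. -/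
open Real MeasureTheory

/-- Differentiation under the interval integral sign for jointly continuous derivative. -/
lemma hasDerivAt_param (f f' : ℝ → ℝ → ℂ) (a b : ℝ)
    (hf : Continuous (Function.uncurry f)) (hf' : Continuous (Function.uncurry f'))
    (h : ∀ t x, HasDerivAt (fun t => f t x) (f' t x) t) (t₀ : ℝ) :
    HasDerivAt (fun t => ∫ x in a..b, f t x) (∫ x in a..b, f' t₀ x) t₀ := by
  have hcf : ∀ t, Continuous (f t) := fun t => hf.comp (Continuous.prodMk_right t)
  have hcf' : ∀ t, Continuous (f' t) := fun t => hf'.comp (Continuous.prodMk_right t)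
  obtain ⟨C, hC⟩ := ((isCompact_Icc (a := t₀ - 1) (b := t₀ + 1)).prod
    (isCompact_uIcc (a := a) (b := b))).exists_bound_of_continuousOn hf'.continuousOn
  refine (intervalIntegral.hasDerivAt_integral_of_dominated_loc_of_deriv_le
    (bound := fun _ => C) (s := Set.Icc (t₀ - 1) (t₀ + 1))
    (Icc_mem_nhds (by linarith) (by linarith))
    (Filter.Eventually.of_forall fun t => (hcf t).aestronglyMeasurable)
    ((hcf t₀).intervalIntegrable _ _) ((hcf' t₀).aestronglyMeasurable) ?_
    intervalIntegrable_const ?_).2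
  · refine Filter.Eventually.of_forall fun x hx t ht => ?_
    exact hC (t, x) ⟨ht, Set.uIoc_subset_uIcc hx⟩
  · exact Filter.Eventually.of_forall fun x _ t _ => h t x

lemma rot_abs (G Gt Gθ Gφ : ℝ → ℝ → ℝ → ℂ)
    (dt : ∀ t θ φ, HasDerivAt (fun t => G t θ φ) (Gt t θ φ) t)
    (dθ : ∀ t θ φ, HasDerivAt (fun θ => G t θ φ) (Gθ t θ φ) θ)
    (dφ : ∀ t θ φ, HasDerivAt (fun φ => G t θ φ) (Gφ t θ φ) φ)
    (hG : Continuous fun q : ℝ × ℝ × ℝ => G q.1 q.2.1 q.2.2)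
    (hGt : Continuous fun q : ℝ × ℝ × ℝ => Gt q.1 q.2.1 q.2.2)
    (hGθ : Continuous fun q : ℝ × ℝ × ℝ => Gθ q.1 q.2.1 q.2.2)
    (hGφ : Continuous fun q : ℝ × ℝ × ℝ => Gφ q.1 q.2.1 q.2.2)
    (t : ℝ)
    (key : ∀ θ φ, ((Real.sin θ : ℝ) : ℂ) * Gt t θ φ
      = (((Real.cos θ * Real.cos φ : ℝ) : ℂ) * G t θ φ
          + ((Real.sin θ * Real.cos φ : ℝ) : ℂ) * Gθ t θ φ)
        - (((Real.cos θ * Real.cos φ : ℝ) : ℂ) * G t θ φ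
          + ((Real.cos θ * Real.sin φ : ℝ) : ℂ) * Gφ t θ φ)) :
    HasDerivAt (fun t => ∫ θ in (0:ℝ)..π, ∫ φ in (0:ℝ)..(2*π),
      ((Real.sin θ : ℝ) : ℂ) * G t θ φ) 0 t := by
  have inner : ∀ s θ, HasDerivAt (fun t => ∫ φ in (0:ℝ)..(2*π), ((Real.sin θ : ℝ) : ℂ) * G t θ φ)
      (∫ φ in (0:ℝ)..(2*π), ((Real.sin θ : ℝ) : ℂ) * Gt s θ φ) s := by
    intro s θ
    refine hasDerivAt_param (fun t φ => ((Real.sin θ : ℝ) : ℂ) * G t θ φ)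
      (fun s φ => ((Real.sin θ : ℝ) : ℂ) * Gt s θ φ) _ _ ?_ ?_ ?_ s
    · exact continuous_const.mul (hG.comp (by fun_prop : Continuous fun q : ℝ × ℝ => (q.1, θ, q.2)))
    · exact continuous_const.mul (hGt.comp (by fun_prop : Continuous fun q : ℝ × ℝ => (q.1, θ, q.2)))
    · exact fun t φ => (dt t θ φ).const_mul _
  have as : Continuous fun q : (ℝ × ℝ) × ℝ => (q.1.1, q.1.2, q.2) := by fun_prop
  have outer := hasDerivAt_param
    (fun t θ => ∫ φ in (0:ℝ)..(2*π), ((Real.sin θ : ℝ) : ℂ) * G t θ φ)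
    (fun s θ => ∫ φ in (0:ℝ)..(2*π), ((Real.sin θ : ℝ) : ℂ) * Gt s θ φ)
    0 π
    (intervalIntegral.continuous_parametric_intervalIntegral_of_continuous'
      (f := fun (q : ℝ × ℝ) φ => ((Real.sin q.2 : ℝ) : ℂ) * G q.1 q.2 φ)
      ((by fun_prop : Continuous fun q : (ℝ × ℝ) × ℝ => ((Real.sin q.1.2 : ℝ) : ℂ)).mul
        (hG.comp as)) _ _)
    (intervalIntegral.continuous_parametric_intervalIntegral_of_continuous'
      (f := fun (q : ℝ × ℝ) φ => ((Real.sin q.2 : ℝ) : ℂ) *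
        Gt q.1 q.2 φ)
      ((by fun_prop : Continuous fun q : (ℝ × ℝ) × ℝ => ((Real.sin q.1.2 : ℝ) : ℂ)).mul
        (hGt.comp as)) _ _)
    inner t
  refine outer.congr_deriv ?_
  have ct : Continuous fun q : ℝ × ℝ => (t, q.1, q.2) := by fun_prop
  have c1 : Continuous fun q : ℝ × ℝ => (((Real.cos q.1 * Real.cos q.2 : ℝ) : ℂ) * G t q.1 q.2
          + ((Real.sin q.1 * Real.cos q.2 : ℝ) : ℂ) * Gθ t q.1 q.2) :=
    ((by fun_prop : Continuous fun q : ℝ × ℝ => ((Real.cos q.1 * Real.cos q.2 : ℝ) : ℂ)).mul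
      (hG.comp ct)).add
    ((by fun_prop : Continuous fun q : ℝ × ℝ => ((Real.sin q.1 * Real.cos q.2 : ℝ) : ℂ)).mul
      (hGθ.comp ct))
  have c2 : Continuous fun q : ℝ × ℝ => (((Real.cos q.1 * Real.cos q.2 : ℝ) : ℂ) * G t q.1 q.2
          + ((Real.cos q.1 * Real.sin q.2 : ℝ) : ℂ) * Gφ t q.1 q.2) :=
    ((by fun_prop : Continuous fun q : ℝ × ℝ => ((Real.cos q.1 * Real.cos q.2 : ℝ) : ℂ)).mul
      (hG.comp ct)).add
    ((by fun_prop : Continuous fun q : ℝ × ℝ => ((Real.cos q.1 * Real.sin q.2 : ℝ) : ℂ)).mul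
      (hGφ.comp ct))
  have c3 : Continuous fun q : ℝ × ℝ => ((Real.sin q.1 * Real.cos q.2 : ℝ) : ℂ) * G t q.1 q.2 :=
    (by fun_prop : Continuous fun q : ℝ × ℝ => ((Real.sin q.1 * Real.cos q.2 : ℝ) : ℂ)).mul
      (hG.comp ct)
  have split : ∀ θ, (∫ φ in (0:ℝ)..(2*π), ((Real.sin θ : ℝ) : ℂ) * Gt t θ φ)
      = ∫ φ in (0:ℝ)..(2*π), (((Real.cos θ * Real.cos φ : ℝ) : ℂ) * G t θ φ
          + ((Real.sin θ * Real.cos φ : ℝ) : ℂ) * Gθ t θ φ) := by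
    intro θ
    simp_rw [key]
    have i1 := (c1.comp (Continuous.prodMk_right θ)).intervalIntegrable (μ := volume) 0 (2*π)
    have i2 := (c2.comp (Continuous.prodMk_right θ)).intervalIntegrable (μ := volume) 0 (2*π)
    have := intervalIntegral.integral_sub i1 i2
    simp only [Function.comp_def] at this i2
    rw [this]
    have z := intervalIntegral.integral_eq_sub_of_hasDerivAt (a := 0) (b := 2*π)
      (f := fun φ => ((Real.cos θ * Real.sin φ : ℝ) : ℂ) * G t θ φ)
      (fun φ _ => (((Real.hasDerivAt_sin φ).const_mul (Real.cos θ)).ofReal_comp).mul (dφ t θ φ)) i2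
    rw [z]
    simp
  simp_rw [split]
  have K := fun θ => hasDerivAt_param
    (fun θ φ => ((Real.sin θ * Real.cos φ : ℝ) : ℂ) * G t θ φ)
    (fun θ φ => (((Real.cos θ * Real.cos φ : ℝ) : ℂ) * G t θ φ
          + ((Real.sin θ * Real.cos φ : ℝ) : ℂ) * Gθ t θ φ))
    0 (2*π) c3 c1 (fun θ φ =>
      (((Real.hasDerivAt_sin θ).mul_const (Real.cos φ)).ofReal_comp).mul (dθ t θ φ)) θ
  rw [intervalIntegral.integral_eq_sub_of_hasDerivAt (fun θ _ => K θ)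
    ((intervalIntegral.continuous_parametric_intervalIntegral_of_continuous' c1 _ _).intervalIntegrable _ _)]
  simp

/-- The rotated parametrization of the sphere. -/
noncomputable def rotP (t θ φ : ℝ) : ℝ × ℝ × ℝ :=
  (Real.cos t * (Real.sin θ * Real.cos φ) + Real.sin t * Real.cos θ, Real.sin θ * Real.sin φ,
    -Real.sin t * (Real.sin θ * Real.cos φ) + Real.cos t * Real.cos θ)

lemma rot_deriv (F : ℝ × ℝ × ℝ → ℂ) (hF : ContDiff ℝ 1 F) (t : ℝ) :
    HasDerivAt (fun t => ∫ θ in (0:ℝ)..π, ∫ φ in (0:ℝ)..(2*π),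
      ((Real.sin θ : ℝ) : ℂ) * F (rotP t θ φ)) 0 t := by
  have hFc : Continuous F := hF.continuous
  have hDc : Continuous (fderiv ℝ F) := hF.continuous_fderiv (by norm_num)
  have hFd : ∀ p, HasFDerivAt F (fderiv ℝ F p) p := fun p =>
    (hF.differentiable (by norm_num) p).hasFDerivAt
  set pt : ℝ → ℝ → ℝ → ℝ × ℝ × ℝ := fun t θ φ =>
    (-Real.sin t * (Real.sin θ * Real.cos φ) + Real.cos t * Real.cos θ, 0,
      -Real.cos t * (Real.sin θ * Real.cos φ) + -Real.sin t * Real.cos θ) with hpt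
  set pθ : ℝ → ℝ → ℝ → ℝ × ℝ × ℝ := fun t θ φ =>
    (Real.cos t * (Real.cos θ * Real.cos φ) + Real.sin t * -Real.sin θ, Real.cos θ * Real.sin φ,
      -Real.sin t * (Real.cos θ * Real.cos φ) + Real.cos t * -Real.sin θ) with hpθ
  set pφ : ℝ → ℝ → ℝ → ℝ × ℝ × ℝ := fun t θ φ =>
    (Real.cos t * (Real.sin θ * -Real.sin φ), Real.sin θ * Real.cos φ,
      -Real.sin t * (Real.sin θ * -Real.sin φ)) with hpφ
  have dt : ∀ t θ φ, HasDerivAt (fun t => F (rotP t θ φ)) (fderiv ℝ F (rotP t θ φ) (pt t θ φ)) t := by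
    intro t θ φ
    refine (hFd _).comp_hasDerivAt t (HasDerivAt.prodMk ?_ (HasDerivAt.prodMk ?_ ?_))
    · exact ((Real.hasDerivAt_cos t).mul_const _).add ((Real.hasDerivAt_sin t).mul_const _)
    · exact hasDerivAt_const _ _
    · exact ((Real.hasDerivAt_sin t).neg.mul_const _).add ((Real.hasDerivAt_cos t).mul_const _)
  have dθ : ∀ t θ φ, HasDerivAt (fun θ => F (rotP t θ φ)) (fderiv ℝ F (rotP t θ φ) (pθ t θ φ)) θ := by
    intro t θ φ
    refine (hFd _).comp_hasDerivAt θ (HasDerivAt.prodMk ?_ (HasDerivAt.prodMk ?_ ?_))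
    · exact (((Real.hasDerivAt_sin θ).mul_const _).const_mul _).add
        ((Real.hasDerivAt_cos θ).const_mul _)
    · exact (Real.hasDerivAt_sin θ).mul_const _
    · exact (((Real.hasDerivAt_sin θ).mul_const _).const_mul _).add
        ((Real.hasDerivAt_cos θ).const_mul _)
  have dφ : ∀ t θ φ, HasDerivAt (fun φ => F (rotP t θ φ)) (fderiv ℝ F (rotP t θ φ) (pφ t θ φ)) φ := by
    intro t θ φ
    refine (hFd _).comp_hasDerivAt φ (HasDerivAt.prodMk ?_ (HasDerivAt.prodMk ?_ ?_))
    · exact (((Real.hasDerivAt_cos φ).const_mul _).const_mul _).add_const _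
    · exact (Real.hasDerivAt_sin φ).const_mul _
    · exact (((Real.hasDerivAt_cos φ).const_mul _).const_mul _).add_const _
  have hPc : Continuous fun q : ℝ × ℝ × ℝ => rotP q.1 q.2.1 q.2.2 := by
    unfold rotP; fun_prop
  have hptc : Continuous fun q : ℝ × ℝ × ℝ => pt q.1 q.2.1 q.2.2 := by
    simp only [hpt]; fun_prop
  have hpθc : Continuous fun q : ℝ × ℝ × ℝ => pθ q.1 q.2.1 q.2.2 := by
    simp only [hpθ]; fun_prop
  have hpφc : Continuous fun q : ℝ × ℝ × ℝ => pφ q.1 q.2.1 q.2.2 := by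
    simp only [hpφ]; fun_prop
  have hG : Continuous fun q : ℝ × ℝ × ℝ => F (rotP q.1 q.2.1 q.2.2) := hFc.comp hPc
  have hGt : Continuous fun q : ℝ × ℝ × ℝ =>
      fderiv ℝ F (rotP q.1 q.2.1 q.2.2) (pt q.1 q.2.1 q.2.2) := (hDc.comp hPc).clm_apply hptc
  have hGθ : Continuous fun q : ℝ × ℝ × ℝ =>
      fderiv ℝ F (rotP q.1 q.2.1 q.2.2) (pθ q.1 q.2.1 q.2.2) := (hDc.comp hPc).clm_apply hpθc
  have hGφ : Continuous fun q : ℝ × ℝ × ℝ =>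
      fderiv ℝ F (rotP q.1 q.2.1 q.2.2) (pφ q.1 q.2.1 q.2.2) := (hDc.comp hPc).clm_apply hpφc
  have key : ∀ θ φ, ((Real.sin θ : ℝ) : ℂ) * fderiv ℝ F (rotP t θ φ) (pt t θ φ)
      = (((Real.cos θ * Real.cos φ : ℝ) : ℂ) * F (rotP t θ φ)
          + ((Real.sin θ * Real.cos φ : ℝ) : ℂ) * fderiv ℝ F (rotP t θ φ) (pθ t θ φ))
        - (((Real.cos θ * Real.cos φ : ℝ) : ℂ) * F (rotP t θ φ)
          + ((Real.cos θ * Real.sin φ : ℝ) : ℂ) * fderiv ℝ F (rotP t θ φ) (pφ t θ φ)) := by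
    intro θ φ
    have hv : (Real.sin θ) • pt t θ φ
        = (Real.sin θ * Real.cos φ) • pθ t θ φ - (Real.cos θ * Real.sin φ) • pφ t θ φ := by
      have e := Real.sin_sq_add_cos_sq φ
      simp only [hpt, hpθ, hpφ, Prod.smul_mk, Prod.mk_sub_mk, smul_eq_mul]
      refine Prod.ext ?_ (Prod.ext ?_ ?_)
      · simp only
        linear_combination (-(Real.cos t * Real.sin θ * Real.cos θ)) * e
      · simp only
        ring
      · simp only
        linear_combination (Real.sin t * Real.sin θ * Real.cos θ) * e
    have h2 := congrArg (fderiv ℝ F (rotP t θ φ)) hv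
    simp only [map_sub, map_smul, Complex.real_smul] at h2
    rw [h2]; ring
  exact rot_abs (fun t θ φ => F (rotP t θ φ))
    (fun t θ φ => fderiv ℝ F (rotP t θ φ) (pt t θ φ))
    (fun t θ φ => fderiv ℝ F (rotP t θ φ) (pθ t θ φ))
    (fun t θ φ => fderiv ℝ F (rotP t θ φ) (pφ t θ φ)) dt dθ dφ hG hGt hGθ hGφ t key

lemma rot_inv_s16 (F : ℝ × ℝ × ℝ → ℂ) (hF : ContDiff ℝ 1 F) (t s : ℝ) :
    (∫ θ in (0:ℝ)..π, ∫ φ in (0:ℝ)..(2*π), ((Real.sin θ : ℝ) : ℂ) * F (rotP t θ φ))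
    = ∫ θ in (0:ℝ)..π, ∫ φ in (0:ℝ)..(2*π), ((Real.sin θ : ℝ) : ℂ) * F (rotP s θ φ) :=
  is_const_of_deriv_eq_zero (fun t => (rot_deriv F hF t).differentiableAt)
    (fun t => (rot_deriv F hF t).deriv) t s

lemma last_int (r : ℝ) (hr : r ≠ 0) :
    (∫ θ in (0:ℝ)..π, ((Real.sin θ : ℝ) : ℂ) * ((3 * Real.cos θ ^ 2 - 1 : ℝ) : ℂ) *
      Complex.exp (Complex.I * (r * (Real.cos θ : ℝ)))) = ((-4 * sphBesselj2 r : ℝ) : ℂ) := by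
  have hr' : (r : ℂ) ≠ 0 := by exact_mod_cast hr
  set w : ℂ := Complex.I * r with hw
  have hw0 : w ≠ 0 := mul_ne_zero Complex.I_ne_zero hr'
  have hd : ∀ t : ℂ, HasDerivAt (fun t : ℂ => -(Complex.exp (w * t) *
      ((3 * t^2 - 1) / w - 6 * t / w^2 + 6 / w^3))) (-((3*t^2-1) * Complex.exp (w * t))) t := by
    intro t
    have h1 : HasDerivAt (fun t : ℂ => Complex.exp (w * t)) (Complex.exp (w * t) * (w * 1)) t :=
      ((hasDerivAt_id t).const_mul w).cexp
    have h2 : HasDerivAt (fun t : ℂ => (3 * t^2 - 1) / w - 6 * t / w^2 + 6 / w^3)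
        ((3 * (2 * t)) / w - 6 * 1 / w^2) t := by
      have := ((((((hasDerivAt_id t).pow 2).const_mul 3).sub_const 1).div_const w).sub
        (((hasDerivAt_id t).const_mul 6).div_const (w^2))).add_const (6 / w^3)
      simpa using this
    refine (h1.mul h2).neg.congr_deriv ?_
    field_simp
    ring
  have hd2 : ∀ θ : ℝ, HasDerivAt (fun θ : ℝ => -(Complex.exp (w * (Real.cos θ : ℝ)) *
      ((3 * ((Real.cos θ : ℝ) : ℂ)^2 - 1) / w - 6 * ((Real.cos θ : ℝ) : ℂ) / w^2 + 6 / w^3)))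
      (((Real.sin θ : ℝ) : ℂ) * ((3 * Real.cos θ ^ 2 - 1 : ℝ) : ℂ) *
      Complex.exp (Complex.I * (r * (Real.cos θ : ℝ)))) θ := by
    intro θ
    refine ((hd ((Real.cos θ : ℝ) : ℂ)).comp θ (Real.hasDerivAt_cos θ).ofReal_comp).congr_deriv ?_
    rw [hw]
    push_cast
    rw [mul_assoc Complex.I]
    ring
  rw [intervalIntegral.integral_eq_sub_of_hasDerivAt (fun θ _ => hd2 θ)
    (Continuous.intervalIntegrable (by fun_prop) _ _)]
  have e1 : Complex.exp (w * ((1:ℝ):ℂ)) = Real.cos r + Real.sin r * Complex.I := by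
    rw [hw, Complex.ofReal_one, mul_one, mul_comm, Complex.exp_mul_I]; push_cast; rfl
  have e2 : Complex.exp (w * ((-1:ℝ):ℂ)) = Real.cos r - Real.sin r * Complex.I := by
    have : w * ((-1:ℝ):ℂ) = (-r : ℂ) * Complex.I := by rw [hw]; push_cast; ring
    rw [this, Complex.exp_mul_I]; simp [sub_eq_add_neg]
  simp only [Real.cos_pi, Real.cos_zero]
  rw [e1, e2, sphBesselj2, hw]
  push_cast
  have hI2 : Complex.I ^ 2 = -1 := Complex.I_sq
  have hI3 : Complex.I ^ 3 = -Complex.I := by rw [pow_succ, hI2]; ring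
  have hII : Complex.I⁻¹ = -Complex.I := Complex.inv_I
  simp only [mul_pow, hI2, hI3, div_eq_mul_inv, mul_inv, hII, inv_neg, inv_one]
  field_simp
  ring_nf
  simp only [hI2]
  ring

lemma phi_int (s c ca sa cb sb : ℝ) (E : ℂ) :
    (∫ φ in (0:ℝ)..(2*π), (s : ℂ) * (((((ca * (s * Real.cos φ) + sa * c) * cb - s * Real.sin φ * sb) *
      ((ca * (s * Real.cos φ) + sa * c) * sb + s * Real.sin φ * cb) : ℝ) : ℂ) * E))
    = (s : ℂ) * ((π * (ca^2 * s^2 + 2 * sa^2 * c^2 - s^2) * (sb * cb) : ℝ) : ℂ) * E := by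
  have hd : ∀ φ : ℝ, HasDerivAt (fun φ : ℝ =>
      sb * cb * (ca^2 * s^2 * ((φ + Real.sin φ * Real.cos φ) / 2) + 2 * ca * sa * s * c * Real.sin φ
        + sa^2 * c^2 * φ - s^2 * ((φ - Real.sin φ * Real.cos φ) / 2))
      + (cb^2 - sb^2) * (ca * s^2 * (Real.sin φ * Real.sin φ / 2) - sa * c * s * Real.cos φ))
      (((ca * (s * Real.cos φ) + sa * c) * cb - s * Real.sin φ * sb) *
      ((ca * (s * Real.cos φ) + sa * c) * sb + s * Real.sin φ * cb)) φ := by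
    intro φ
    have hs := Real.hasDerivAt_sin φ
    have hc := Real.hasDerivAt_cos φ
    have hi := hasDerivAt_id φ
    have := ((((((((hi.add (hs.mul hc)).div_const 2).const_mul (ca^2 * s^2)).add
      (hs.const_mul (2 * ca * sa * s * c))).add (hi.const_mul (sa^2*c^2))).sub
      (((hi.sub (hs.mul hc)).div_const 2).const_mul (s^2)))).const_mul (sb*cb)).add
      (((((hs.mul hs).div_const 2).const_mul (ca*s^2)).sub (hc.const_mul (sa*c*s))).const_mul
        (cb^2-sb^2))
    refine this.congr_deriv ?_
    have e := Real.sin_sq_add_cos_sq φ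
    linear_combination (- sb * cb * (ca^2 * s^2 - s^2) / 2) * e
  rw [intervalIntegral.integral_const_mul, intervalIntegral.integral_mul_const,
    intervalIntegral.integral_ofReal,
    intervalIntegral.integral_eq_sub_of_hasDerivAt (fun φ _ => hd φ)
    (Continuous.intervalIntegrable (by fun_prop) _ _)]
  simp only [Real.sin_two_pi, Real.cos_two_pi, Real.sin_zero, Real.cos_zero]
  push_cast
  ring

theorem sphere_integral_d1d2_exp (z : EuclideanSpace ℝ (Fin 3)) (hz : z ≠ 0)
    (k α β : ℝ) (hk : 0 < k)
    (h0 : z 0 = ‖z‖ * Real.sin α * Real.cos β)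
    (h1 : z 1 = ‖z‖ * Real.sin α * Real.sin β)
    (h2 : z 2 = ‖z‖ * Real.cos α) :
    (∫ θ in (0:ℝ)..π, ∫ φ in (0:ℝ)..(2*π),
        ((Real.sin θ * Real.cos φ) * (Real.sin θ * Real.sin φ) : ℂ) *
          Complex.exp (Complex.I * (k * (Real.sin θ * Real.cos φ * z 0
            + Real.sin θ * Real.sin φ * z 1 + Real.cos θ * z 2))) * (Real.sin θ : ℂ))
      = (-(2 * π) * sphBesselj2 (k * ‖z‖) * (Real.sin α)^2 * Real.sin (2*β) : ℝ) := by
  have hr : k * ‖z‖ ≠ 0 := mul_ne_zero hk.ne' (norm_ne_zero_iff.mpr hz)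
  rw [h0, h1, h2]
  set n := ‖z‖ with hn
  set F : ℝ × ℝ × ℝ → ℂ := fun p =>
    ((((Real.cos α * p.1 + Real.sin α * p.2.2) * Real.cos β - p.2.1 * Real.sin β) *
      ((Real.cos α * p.1 + Real.sin α * p.2.2) * Real.sin β + p.2.1 * Real.cos β) : ℝ) : ℂ) *
      Complex.exp (Complex.I * (((k * n : ℝ) : ℂ) * ((p.2.2 : ℝ) : ℂ))) with hF
  have hFs : ContDiff ℝ 1 F := by
    have hof : ∀ {g : ℝ × ℝ × ℝ → ℝ}, ContDiff ℝ 1 g → ContDiff ℝ 1 (fun p => ((g p : ℝ) : ℂ)) :=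
      fun hg => Complex.ofRealCLM.contDiff.comp hg
    refine (hof (by fun_prop)).mul ?_
    exact (contDiff_const.mul (contDiff_const.mul (hof (by fun_prop)))).cexp
  have e1 := Real.sin_sq_add_cos_sq α
  have e2 := Real.sin_sq_add_cos_sq β
  have shift : ∀ θ : ℝ, (∫ φ in (0:ℝ)..(2*π),
        ((Real.sin θ * Real.cos φ) * (Real.sin θ * Real.sin φ) : ℂ) *
          Complex.exp (Complex.I * (k * (Real.sin θ * Real.cos φ * ((n * Real.sin α * Real.cos β : ℝ) : ℂ)
            + Real.sin θ * Real.sin φ * ((n * Real.sin α * Real.sin β : ℝ) : ℂ)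
            + Real.cos θ * ((n * Real.cos α : ℝ) : ℂ)))) * (Real.sin θ : ℂ))
      = ∫ φ in (0:ℝ)..(2*π), ((Real.sin θ : ℝ) : ℂ) * F (rotP (-α) θ φ) := by
    intro θ
    set f : ℝ → ℂ := fun φ => ((Real.sin θ * Real.cos φ) * (Real.sin θ * Real.sin φ) : ℂ) *
          Complex.exp (Complex.I * (k * (Real.sin θ * Real.cos φ * ((n * Real.sin α * Real.cos β : ℝ) : ℂ)
            + Real.sin θ * Real.sin φ * ((n * Real.sin α * Real.sin β : ℝ) : ℂ)
            + Real.cos θ * ((n * Real.cos α : ℝ) : ℂ)))) * (Real.sin θ : ℂ) with hf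
    have hper : Function.Periodic f (2*π) := by
      intro φ
      simp only [hf, Real.cos_add_two_pi, Real.sin_add_two_pi]
    have h := hper.intervalIntegral_add_eq 0 β
    rw [zero_add] at h
    rw [h, add_comm β (2*π)]
    have h' := intervalIntegral.integral_comp_add_right (a := 0) (b := 2*π) f β
    rw [zero_add] at h'
    rw [← h']
    refine intervalIntegral.integral_congr fun φ _ => ?_
    simp only [hf, hF, rotP, Real.cos_neg, Real.sin_neg]
    have a1 : Real.cos α * (Real.cos α * (Real.sin θ * Real.cos φ) + -Real.sin α * Real.cos θ) +
        Real.sin α * (- -Real.sin α * (Real.sin θ * Real.cos φ) + Real.cos α * Real.cos θ)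
        = Real.sin θ * Real.cos φ := by
      linear_combination (Real.sin θ * Real.cos φ) * e1
    rw [a1]
    have a2 : Complex.I * (k * (Real.sin θ * Real.cos (φ + β) * ((n * Real.sin α * Real.cos β : ℝ) : ℂ)
            + Real.sin θ * Real.sin (φ + β) * ((n * Real.sin α * Real.sin β : ℝ) : ℂ)
            + Real.cos θ * ((n * Real.cos α : ℝ) : ℂ)))
        = Complex.I * (((k * n : ℝ) : ℂ) *
          ((- -Real.sin α * (Real.sin θ * Real.cos φ) + Real.cos α * Real.cos θ : ℝ) : ℂ)) := by
      congr 1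
      norm_cast
      rw [Real.cos_add, Real.sin_add]
      linear_combination (k * n * Real.sin θ * Real.sin α * Real.cos φ) * e2
    rw [a2, Real.cos_add, Real.sin_add]
    push_cast
    ring
  simp_rw [shift]
  rw [rot_inv_s16 F hFs (-α) 0]
  have inn : ∀ θ : ℝ, (∫ φ in (0:ℝ)..(2*π), ((Real.sin θ : ℝ) : ℂ) * F (rotP 0 θ φ))
      = ((π * Real.sin α ^ 2 * (Real.sin β * Real.cos β) : ℝ) : ℂ) *
        (((Real.sin θ : ℝ) : ℂ) * ((3 * Real.cos θ ^ 2 - 1 : ℝ) : ℂ) *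
          Complex.exp (Complex.I * (((k * n : ℝ) : ℂ) * ((Real.cos θ : ℝ) : ℂ)))) := by
    intro θ
    have := phi_int (Real.sin θ) (Real.cos θ) (Real.cos α) (Real.sin α) (Real.cos β) (Real.sin β)
      (Complex.exp (Complex.I * (((k * n : ℝ) : ℂ) * ((Real.cos θ : ℝ) : ℂ))))
    have a3 : π * (Real.cos α^2 * Real.sin θ^2 + 2 * Real.sin α^2 * Real.cos θ^2 - Real.sin θ^2) *
        (Real.sin β * Real.cos β) = π * Real.sin α ^ 2 * (Real.sin β * Real.cos β) *
        (3 * Real.cos θ ^ 2 - 1) := by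
      have e3 := Real.sin_sq_add_cos_sq θ
      rw [Real.cos_sq' α, Real.sin_sq θ]
      ring
    rw [a3] at this
    simp only [hF, rotP, Real.cos_zero, Real.sin_zero, one_mul, zero_mul, neg_zero, zero_add, add_zero]
    rw [this]
    push_cast
    ring
  simp_rw [inn]
  rw [intervalIntegral.integral_const_mul, last_int _ hr, Real.sin_two_mul]
  push_cast
  ring
end
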